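/- Fix real numbers α < 0 and θ > −α. A map V : ℕ × ℕ₀ → [0,∞) is an (α,θ)-solution if and only if there exists a sequence (p_N)_{N ∈ ℕ₀} of nonnegative reals with Σ_{N=0}^{∞} p_N = 1 such that V_{n,k} = Σ_{N=0}^{∞} p_N V^{BB,α,θ}_{n,k}(N) for all n ∈ ℕ and k ∈ ℕ₀. (Theorem 1.1, case α < 0: the solutions are exactly the mixtures over the dimensionality N of the Beta–Bernoulli weights.) -/

import Mathlib

open scoped BigOperators

/-- Rising factorial `(x)_{j↑} = x(x+1)⋯(x+j-1)`. -/
noncomputable def risingFac (x : ℝ) (j : ℕ) : ℝ :=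
  ∏ i ∈ Finset.range j, (x + i)

/-- `V` is an `(α,θ)`-solution of the consistency recursion. -/
def IsSolution (α θ : ℝ) (V : ℕ → ℕ → ℝ) : Prop :=
  HasSum (fun j => V 1 j) 1 ∧
  ∀ n : ℕ, 1 ≤ n → ∀ k : ℕ,
    HasSum
      (fun j : ℕ =>
        (Nat.choose (k + j) j : ℝ) * (risingFac (θ + α) n) ^ j *
          (θ + (n : ℝ)) ^ k * V (n + 1) (k + j))
      (V n k)

/-- Beta–Bernoulli weights `V^{BB,α,θ}_{n,k}(N)`. -/
noncomputable def VBB (α θ : ℝ) (N n k : ℕ) : ℝ :=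
  (Nat.choose N k : ℝ) * ((-α) * Real.Gamma (θ + α) / Real.Gamma (θ + α + n)) ^ k *
    (Real.Gamma (θ + α + n) * Real.Gamma θ /
      (Real.Gamma (θ + α) * Real.Gamma (θ + n))) ^ N

open Filter Topology

/-- Interchange of the order of summation for nonnegative double series. -/
lemma hasSum_interchange {ι κ : Type*} {f : ι → κ → ℝ} {g : ι → ℝ} {h : κ → ℝ} {a : ℝ}
    (hf : ∀ i j, 0 ≤ f i j) (hg : ∀ i, HasSum (f i) (g i))
    (hh : ∀ j, HasSum (fun i => f i j) (h j)) (ha : HasSum g a) : HasSum h a := by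
  have hs : Summable (fun x : ι × κ => f x.1 x.2) := by
    refine (summable_prod_of_nonneg fun x => hf x.1 x.2).2 ⟨fun i => (hg i).summable, ?_⟩
    simpa only [(hg _).tsum_eq] using ha.summable
  have hsum := hs.hasSum
  rw [(hsum.prod_fiberwise hg).unique ha] at hsum
  exact ((Equiv.prodComm κ ι).hasSum_iff.2 hsum).prod_fiberwise hh

/-- The binomial weights: the probability of keeping `k` out of `N` points when each point is kept
with probability `t`. -/
noncomputable def binomialWeight (t : ℝ) (N k : ℕ) : ℝ :=
  (N.choose k : ℝ) * t ^ k * (1 - t) ^ (N - k)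

lemma binomialWeight_nonneg {t : ℝ} (h0 : 0 ≤ t) (h1 : t ≤ 1) (N k : ℕ) :
    0 ≤ binomialWeight t N k := by
  have := sub_nonneg.2 h1
  unfold binomialWeight
  positivity

lemma binomialWeight_eq_zero {N k : ℕ} (h : N < k) (t : ℝ) : binomialWeight t N k = 0 := by
  simp [binomialWeight, Nat.choose_eq_zero_of_lt h]

lemma hasSum_binomialWeight (t : ℝ) (N : ℕ) : HasSum (binomialWeight t N) 1 := by
  have h : ∑ k ∈ Finset.range (N + 1), binomialWeight t N k = 1 := by
    have := add_pow t (1 - t) N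
    rw [add_sub_cancel, one_pow] at this
    rw [this]
    exact Finset.sum_congr rfl fun k _ => by unfold binomialWeight; ring
  rw [← h]
  refine hasSum_sum_of_ne_finset_zero fun k hk => binomialWeight_eq_zero ?_ t
  rw [Finset.mem_range] at hk
  omega

/-- Successive thinnings with probabilities `s` and `t` amount to a thinning with probability
`s * t`. -/
lemma hasSum_binomialWeight_mul (s t : ℝ) (L k : ℕ) :
    HasSum (fun M => binomialWeight s L M * binomialWeight t M k) (binomialWeight (s * t) L k) := by
  rcases lt_or_ge L k with hLk | hkL
  · rw [binomialWeight_eq_zero hLk]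
    convert hasSum_zero using 2 with M
    rcases lt_or_ge L M with h | h
    · simp [binomialWeight_eq_zero h]
    · simp [binomialWeight_eq_zero (h.trans_lt hLk)]
  have hinj : Function.Injective (fun j : ℕ => k + j) := add_right_injective k
  rw [← hinj.hasSum_iff]
  · have h : ∑ j ∈ Finset.range (L - k + 1),
        binomialWeight s L (k + j) * binomialWeight t (k + j) k = binomialWeight (s * t) L k := by
      have hp := add_pow (s * (1 - t)) (1 - s) (L - k)
      have hb : s * (1 - t) + (1 - s) = 1 - s * t := by ring
      rw [hb] at hp
      rw [binomialWeight, hp, Finset.mul_sum]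
      refine Finset.sum_congr rfl fun j hj => ?_
      have hj' : k + j ≤ L := by have := Finset.mem_range.1 hj; omega
      have hc : (L.choose (k + j) : ℝ) * ((k + j).choose k : ℝ)
          = (L.choose k : ℝ) * ((L - k).choose j : ℝ) := by
        have := Nat.choose_mul (n := L) (k := k + j) (s := k) (Nat.le_add_right k j)
        rw [Nat.add_sub_cancel_left] at this
        exact_mod_cast this
      have e : L - (k + j) = L - k - j := by omega
      simp only [binomialWeight, Nat.add_sub_cancel_left, e, pow_add, mul_pow]
      linear_combination (s ^ k * s ^ j * (1 - s) ^ (L - k - j) * t ^ k * (1 - t) ^ j) * hc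
    rw [← h]
    refine hasSum_sum_of_ne_finset_zero fun j hj => ?_
    rw [Function.comp_apply,
      binomialWeight_eq_zero (N := L) (by simp only [Finset.mem_range] at hj; omega), zero_mul]
  · intro M hM
    rw [binomialWeight_eq_zero (N := M), mul_zero]
    by_contra! h
    exact hM ⟨M - k, by simp; omega⟩

lemma binomialWeight_le {s t : ℝ} (hs : 0 ≤ s) (hst : s ≤ t) (ht : t ≤ 1) (N k : ℕ) :
    binomialWeight t N k ≤ (N.choose k : ℝ) * (1 - s) ^ (N - k) := by
  have h1 : t ^ k ≤ 1 := pow_le_one₀ (hs.trans hst) ht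
  have h2 : (1 - t) ^ (N - k) ≤ (1 - s) ^ (N - k) :=
    pow_le_pow_left₀ (sub_nonneg.2 ht) (by linarith) _
  have h3 : 0 ≤ (1 - t) ^ (N - k) := pow_nonneg (sub_nonneg.2 ht) _
  unfold binomialWeight
  rw [mul_assoc]
  refine mul_le_mul_of_nonneg_left ?_ (Nat.cast_nonneg _)
  nlinarith

lemma summable_choose_mul_pow_sub {x : ℝ} (h0 : 0 ≤ x) (h1 : x < 1) (k : ℕ) :
    Summable (fun N : ℕ => (N.choose k : ℝ) * x ^ (N - k)) := by
  have h := summable_choose_mul_geometric_of_norm_lt_one k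
    (show ‖x‖ < 1 by rwa [Real.norm_of_nonneg h0])
  rw [← summable_nat_add_iff k]
  simpa using h

/-- A sequence of nonnegative sequences, the first of total mass one, is consistent under binomial
thinning if and only if all of them are thinnings of a common probability on `ℕ`. -/
theorem consistent_thinning_iff {ρ : ℕ → ℝ} (hpos : ∀ n, 0 < ρ n) (hlt : ∀ n, ρ n < 1)
    (hmono : Monotone ρ) (hlim : Tendsto ρ atTop (𝓝 1)) {P : ℕ → ℕ → ℝ} (hP : ∀ n k, 0 ≤ P n k) :
    (HasSum (P 0) 1 ∧ ∀ n k,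
      HasSum (fun M => P (n + 1) M * binomialWeight (ρ n / ρ (n + 1)) M k) (P n k)) ↔
    ∃ p : ℕ → ℝ, (∀ N, 0 ≤ p N) ∧ HasSum p 1 ∧
      ∀ n k, HasSum (fun N => p N * binomialWeight (ρ n) N k) (P n k) := by
  have hratio0 : ∀ n m, 0 ≤ ρ n / ρ m := fun n m => (div_pos (hpos n) (hpos m)).le
  have hratio1 : ∀ {n m}, n ≤ m → ρ n / ρ m ≤ 1 := fun h => (div_le_one (hpos _)).2 (hmono h)
  constructor
  · rintro ⟨h1, hrec⟩
    have hmass : ∀ n, HasSum (P n) 1 := by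
      intro n
      induction n with
      | zero => exact h1
      | succ n ih =>
        refine hasSum_interchange (fun k M => mul_nonneg (hP _ _) (binomialWeight_nonneg
          (hratio0 n (n + 1)) (hratio1 n.le_succ) M k)) (hrec n) (fun M => ?_) ih
        simpa using (hasSum_binomialWeight (ρ n / ρ (n + 1)) M).mul_left (P (n + 1) M)
    have hcomp : ∀ n k m, n + 1 ≤ m →
        HasSum (fun M => P m M * binomialWeight (ρ n / ρ m) M k) (P n k) := by
      intro n k m hm
      induction m, hm using Nat.le_induction with
      | base => exact hrec n k
      | succ m hm ih =>
        have hnm : n ≤ m := by omega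
        refine hasSum_interchange (f := fun M L => P (m + 1) L *
          binomialWeight (ρ m / ρ (m + 1)) L M * binomialWeight (ρ n / ρ m) M k) (fun M L => ?_)
          (fun M => (hrec m M).mul_right _) (fun L => ?_) ih
        · exact mul_nonneg (mul_nonneg (hP _ _) (binomialWeight_nonneg (hratio0 _ _)
            (hratio1 m.le_succ) _ _)) (binomialWeight_nonneg (hratio0 _ _) (hratio1 hnm) _ _)
        · have h := (hasSum_binomialWeight_mul (ρ m / ρ (m + 1)) (ρ n / ρ m) L k).mul_left
            (P (m + 1) L)
          rw [mul_comm (ρ m / ρ (m + 1)), div_mul_div_cancel₀ (hpos m).ne'] at h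
          simpa only [mul_assoc] using h
    have hle : ∀ n k, P n k ≤ 1 := fun n k => le_hasSum (hmass n) k fun j _ => hP n j
    obtain ⟨p, hp, φ, hφ, hPp⟩ :=
      (isCompact_univ_pi fun _ : ℕ => isCompact_Icc (a := (0 : ℝ)) (b := 1)).tendsto_subseq
        (x := P) fun n k _ => ⟨hP n k, hle n k⟩
    have hp0 : ∀ N, 0 ≤ p N := fun N => (hp N trivial).1
    have hmix : ∀ n k, HasSum (fun N => p N * binomialWeight (ρ n) N k) (P n k) := by
      intro n k
      have hbound := summable_choose_mul_pow_sub (x := 1 - ρ n)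
        (by linarith [hlt n]) (by linarith [hpos n]) k
      have hsummable : Summable (fun N => p N * binomialWeight (ρ n) N k) := by
        refine hbound.of_nonneg_of_le (fun N => mul_nonneg (hp0 N)
          (binomialWeight_nonneg (hpos n).le (hlt n).le _ _)) fun N => ?_
        refine (mul_le_of_le_one_left (binomialWeight_nonneg (hpos n).le (hlt n).le _ _)
          (hp N trivial).2).trans (binomialWeight_le (hpos n).le le_rfl (hlt n).le _ _)
      have hρ : Tendsto (fun m => ρ n / ρ (φ m)) atTop (𝓝 (ρ n)) := by
        simpa [Pi.div_def] using (tendsto_const_nhds (x := ρ n)).div (hlim.comp hφ.tendsto_atTop) one_ne_zero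
      have hev : ∀ᶠ m in atTop, n + 1 ≤ φ m := hφ.tendsto_atTop.eventually_ge_atTop _
      have htend : Tendsto (fun m => ∑' N, P (φ m) N * binomialWeight (ρ n / ρ (φ m)) N k) atTop
          (𝓝 (∑' N, p N * binomialWeight (ρ n) N k)) := by
        refine tendsto_tsum_of_dominated_convergence hbound (fun N => ?_) ?_
        · refine ((tendsto_pi_nhds.1 hPp) N).mul ?_
          have hc : Continuous fun t => binomialWeight t N k := by
            unfold binomialWeight
            fun_prop
          exact (hc.tendsto _).comp hρ
        · filter_upwards [hev] with m hm N
          have h1 := hratio1 (show n ≤ φ m by omega)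
          have hnn := binomialWeight_nonneg (hratio0 n (φ m)) h1 N k
          rw [Real.norm_of_nonneg (mul_nonneg (hP _ _) hnn)]
          refine (mul_le_of_le_one_left hnn (hle _ _)).trans
            (binomialWeight_le (hpos n).le ?_ h1 _ _)
          exact le_div_self (hpos n).le (hpos _) (hlt _).le
      have hconst : Tendsto (fun m => ∑' N, P (φ m) N * binomialWeight (ρ n / ρ (φ m)) N k) atTop
          (𝓝 (P n k)) :=
        tendsto_const_nhds.congr' (hev.mono fun m hm => (hcomp n k _ hm).tsum_eq.symm)
      rw [tendsto_nhds_unique hconst htend]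
      exact hsummable.hasSum
    refine ⟨p, hp0, ?_, hmix⟩
    refine hasSum_interchange (fun k N => mul_nonneg (hp0 N) (binomialWeight_nonneg (hpos 0).le
      (hlt 0).le N k)) (hmix 0) (fun N => ?_) h1
    simpa using (hasSum_binomialWeight (ρ 0) N).mul_left (p N)
  · rintro ⟨p, hp0, hp1, hmix⟩
    refine ⟨?_, fun n k => ?_⟩
    · refine hasSum_interchange (fun N k => mul_nonneg (hp0 N) (binomialWeight_nonneg (hpos 0).le
        (hlt 0).le N k)) (fun N => ?_) (hmix 0) hp1
      simpa using (hasSum_binomialWeight (ρ 0) N).mul_left (p N)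
    · refine hasSum_interchange (f := fun N M => p N * binomialWeight (ρ (n + 1)) N M *
        binomialWeight (ρ n / ρ (n + 1)) M k) (fun N M => ?_) (fun N => ?_)
        (fun M => (hmix (n + 1) M).mul_right _) (hmix n k)
      · exact mul_nonneg (mul_nonneg (hp0 _) (binomialWeight_nonneg (hpos _).le (hlt _).le _ _))
          (binomialWeight_nonneg (hratio0 _ _) (hratio1 n.le_succ) _ _)
      · have h := (hasSum_binomialWeight_mul (ρ (n + 1)) (ρ n / ρ (n + 1)) N k).mul_left (p N)
        rw [mul_div_cancel₀ _ (hpos (n + 1)).ne'] at h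
        simpa only [mul_assoc] using h

lemma risingFac_pos {x : ℝ} (hx : 0 < x) (n : ℕ) : 0 < risingFac x n :=
  Finset.prod_pos fun i _ => by positivity

lemma risingFac_succ (x : ℝ) (n : ℕ) : risingFac x (n + 1) = risingFac x n * (x + n) :=
  Finset.prod_range_succ _ _

lemma Gamma_add_nat {x : ℝ} (hx : 0 < x) (n : ℕ) :
    Real.Gamma (x + n) = risingFac x n * Real.Gamma x := by
  induction n with
  | zero => simp [risingFac]
  | succ n ih =>
    have : x + (n + 1 : ℕ) = (x + n) + 1 := by push_cast; ring
    rw [this, Real.Gamma_add_one (by positivity), ih, risingFac_succ]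
    ring

lemma tendsto_risingFac_div {x y : ℝ} (hx : 0 < x) (hxy : x < y) :
    Tendsto (fun n => risingFac x (n + 1) / risingFac y (n + 1)) atTop (𝓝 0) := by
  have hlim := (((Real.GammaSeq_tendsto_Gamma y).div (Real.GammaSeq_tendsto_Gamma x)
    (Real.Gamma_pos_of_pos hx).ne')).mul
    ((tendsto_rpow_neg_atTop (sub_pos.2 hxy)).comp tendsto_natCast_atTop_atTop)
  rw [mul_zero] at hlim
  refine hlim.congr' ?_
  filter_upwards [eventually_gt_atTop 0] with n hn
  have hn' : (0 : ℝ) < n := Nat.cast_pos.2 hn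
  have h1 := (risingFac_pos hx (n + 1)).ne'
  have h2 := (risingFac_pos (hx.trans hxy) (n + 1)).ne'
  have h3 := (Real.rpow_pos_of_pos hn' x).ne'
  have h4 := (Real.rpow_pos_of_pos hn' y).ne'
  have h5 : (n.factorial : ℝ) ≠ 0 := by positivity
  simp only [Pi.div_apply, Real.GammaSeq, Function.comp_apply, neg_sub, Real.rpow_sub hn']
  change (n : ℝ) ^ y * n.factorial / risingFac y (n + 1) /
    ((n : ℝ) ^ x * n.factorial / risingFac x (n + 1)) * _ = _
  field_simp

/-- Theorem 1.1, case `α < 0`: solutions are exactly mixtures over the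
dimensionality `N` of the Beta–Bernoulli weights. -/
theorem stmt_6
    (α θ : ℝ) (hα : α < 0) (hθ : -α < θ)
    (V : ℕ → ℕ → ℝ) (hVnonneg : ∀ n k, 0 ≤ V n k) :
    IsSolution α θ V ↔
      ∃ p : ℕ → ℝ, (∀ N, 0 ≤ p N) ∧ HasSum p 1 ∧
        ∀ n : ℕ, 1 ≤ n → ∀ k : ℕ,
          HasSum (fun N : ℕ => p N * VBB α θ N n k) (V n k) := by
  have hx : 0 < θ + α := by linarith
  have hy : 0 < θ := by linarith
  set a : ℕ → ℝ := risingFac (θ + α) with ha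
  set b : ℕ → ℝ := risingFac θ with hb
  have ha0 : ∀ n, 0 < a n := risingFac_pos hx
  have hb0 : ∀ n, 0 < b n := risingFac_pos hy
  have ha1 : ∀ n, a (n + 1) = a n * (θ + α + n) := risingFac_succ _
  have hb1 : ∀ n, b (n + 1) = b n * (θ + n) := risingFac_succ _
  have hα0 : α ≠ 0 := hα.ne
  have hr_anti : ∀ n, a (n + 1) / b (n + 1) < a n / b n := by
    intro n
    have : 0 < θ + (n : ℝ) := by positivity
    rw [ha1, hb1, mul_div_mul_comm]
    exact mul_lt_of_lt_one_right (div_pos (ha0 n) (hb0 n)) ((div_lt_one this).2 (by linarith))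
  have hr_strict : StrictAnti fun n => a n / b n := strictAnti_nat_of_succ_lt hr_anti
  set ρ : ℕ → ℝ := fun n => 1 - a (n + 1) / b (n + 1) with hρ
  have hρ_pos : ∀ n, 0 < ρ n := by
    intro n
    have := hr_strict (Nat.succ_pos n)
    simp only [ha, hb, risingFac, Finset.range_zero, Finset.prod_empty, div_one] at this
    simpa [hρ, ha, hb, risingFac] using this
  have hρ_lt : ∀ n, ρ n < 1 := fun n => by
    have := div_pos (ha0 (n + 1)) (hb0 (n + 1))
    simp only [hρ]; linarith
  have hρ_mono : Monotone ρ := monotone_nat_of_le_succ fun n => by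
    have := hr_anti (n + 1)
    simp only [hρ]; linarith
  have hρ_lim : Tendsto ρ atTop (𝓝 1) := by
    simpa using (tendsto_risingFac_div hx (show θ + α < θ by linarith)).const_sub 1
  set D : ℕ → ℝ := fun n => (b (n + 1) - a (n + 1)) / (-α) with hD
  have hDρ : ∀ n, D n = ρ n * b (n + 1) / (-α) := fun n => by
    have := (hb0 (n + 1)).ne'
    simp only [hD, hρ]; field_simp
  have hD0 : ∀ n, 0 < D n := fun n => by
    rw [hDρ]
    exact div_pos (mul_pos (hρ_pos n) (hb0 _)) (by linarith)
  have hDD : ∀ n, (θ + (n + 1 : ℕ)) * D n = ρ n / ρ (n + 1) * D (n + 1) := fun n => by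
    have := (hρ_pos (n + 1)).ne'
    rw [hDρ, hDρ, hb1 (n + 1)]; field_simp
  have haD : ∀ n, a (n + 1) = (1 - ρ n / ρ (n + 1)) * D (n + 1) := fun n => by
    rw [sub_mul, ← hDD, one_mul]
    simp only [hD]
    rw [ha1 (n + 1), hb1 (n + 1)]
    field_simp
    ring
  have key := consistent_thinning_iff hρ_pos hρ_lt hρ_mono hρ_lim
    (P := fun n k => V (n + 1) k * D n ^ k)
    fun n k => mul_nonneg (hVnonneg _ _) (pow_nonneg (hD0 n).le _)
  have hD_zero : D 0 = 1 := by
    simp only [hD, ha, hb, risingFac]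
    simp only [zero_add, Finset.prod_range_one, Nat.cast_zero, add_zero]
    field_simp
    ring
  have hVBB : ∀ N n k, VBB α θ N (n + 1) k * D n ^ k = binomialWeight (ρ n) N k := by
    intro N n k
    rcases lt_or_ge N k with h | h
    · rw [binomialWeight_eq_zero h]
      simp [VBB, Nat.choose_eq_zero_of_lt h]
    · have hG1 := (Real.Gamma_pos_of_pos hx).ne'
      have hG2 := (Real.Gamma_pos_of_pos hy).ne'
      have h1 := (ha0 (n + 1)).ne'
      have h2 := (hb0 (n + 1)).ne'
      have e1 : -α * Real.Gamma (θ + α) / Real.Gamma (θ + α + (n + 1 : ℕ)) = -α / a (n + 1) := by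
        rw [Gamma_add_nat hx]
        change _ / (a (n + 1) * _) = _
        field_simp
      have e2 : Real.Gamma (θ + α + (n + 1 : ℕ)) * Real.Gamma θ /
          (Real.Gamma (θ + α) * Real.Gamma (θ + (n + 1 : ℕ))) = 1 - ρ n := by
        rw [Gamma_add_nat hx, Gamma_add_nat hy]
        change a (n + 1) * _ * _ / (_ * (b (n + 1) * _)) = _
        simp only [hρ, sub_sub_cancel]
        field_simp
      have e3 : -α / a (n + 1) * (1 - ρ n) * D n = ρ n := by
        rw [hDρ]
        simp only [hρ, sub_sub_cancel]
        field_simp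
      rw [VBB, e1, e2, binomialWeight]
      conv_rhs => enter [1, 2]; rw [← e3]
      obtain ⟨j, rfl⟩ := Nat.exists_eq_add_of_le h
      rw [Nat.add_sub_cancel_left, pow_add, mul_pow, mul_pow]
      ring
  have hleft : IsSolution α θ V ↔ (HasSum (fun k => V (0 + 1) k * D 0 ^ k) 1 ∧ ∀ n k,
      HasSum (fun M => V (n + 1 + 1) M * D (n + 1) ^ M * binomialWeight (ρ n / ρ (n + 1)) M k)
        (V (n + 1) k * D n ^ k)) := by
    simp only [hD_zero, one_pow, mul_one]
    refine and_congr Iff.rfl ?_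
    have hstep : ∀ n k, HasSum (fun j : ℕ => (Nat.choose (k + j) j : ℝ) *
          (risingFac (θ + α) (n + 1)) ^ j * (θ + ((n + 1 : ℕ) : ℝ)) ^ k * V (n + 1 + 1) (k + j))
          (V (n + 1) k) ↔
        HasSum (fun M => V (n + 1 + 1) M * D (n + 1) ^ M * binomialWeight (ρ n / ρ (n + 1)) M k)
          (V (n + 1) k * D n ^ k) := by
      intro n k
      have hinj : Function.Injective (fun j : ℕ => k + j) := add_right_injective k
      rw [← hinj.hasSum_iff (f := fun M => V (n + 1 + 1) M * D (n + 1) ^ M *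
        binomialWeight (ρ n / ρ (n + 1)) M k), ← hasSum_mul_right_iff (pow_pos (hD0 n) k).ne']
      · refine iff_of_eq (congrArg (HasSum · _) (funext fun j => ?_))
        change _ * a (n + 1) ^ j * _ * _ * _ = _
        have e : (θ + ((n + 1 : ℕ) : ℝ)) ^ k * D n ^ k =
            (ρ n / ρ (n + 1)) ^ k * D (n + 1) ^ k := by
          rw [← mul_pow, hDD, mul_pow]
        rw [haD, mul_pow, Function.comp_apply, binomialWeight, Nat.add_sub_cancel_left,
          Nat.choose_symm_add, pow_add]
        linear_combination (((k + j).choose j : ℝ) * (1 - ρ n / ρ (n + 1)) ^ j * D (n + 1) ^ j *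
          V (n + 1 + 1) (k + j)) * e
      · intro M hM
        rw [binomialWeight_eq_zero, mul_zero]
        by_contra! h
        exact hM ⟨M - k, by simp; omega⟩
    constructor
    · exact fun h n k => (hstep n k).1 (h (n + 1) n.succ_pos k)
    · intro h n hn k
      obtain ⟨n, rfl⟩ := Nat.exists_eq_add_of_le' hn
      exact (hstep n k).2 (h n k)
  rw [hleft, key]
  refine exists_congr fun p => and_congr Iff.rfl (and_congr Iff.rfl ?_)
  have hterm : ∀ n k, HasSum (fun N => p N * VBB α θ N (n + 1) k) (V (n + 1) k) ↔
      HasSum (fun N => p N * binomialWeight (ρ n) N k) (V (n + 1) k * D n ^ k) := fun n k => by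
    rw [← hasSum_mul_right_iff (pow_pos (hD0 n) k).ne']
    simp only [mul_assoc, hVBB]
  constructor
  · intro h n hn k
    obtain ⟨n, rfl⟩ := Nat.exists_eq_add_of_le' hn
    exact (hterm n k).2 (h n k)
  · exact fun h n k => (hterm n k).1 (h (n + 1) n.succ_pos k)
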